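/- There exist constants c₂ > 0 and c₃ > 0 such that for every α ∈ (0, 1/2], every integer j > 8/α, and every p = (p_1,…,p_j) ∈ [0,1]^j with p_l ≥ 1/2 + α for all l, one has Σ_{s=0}^{⌊j/2⌋−1} f_p(j,s) / F_{j+1,1/2}(s) ≤ c₂ · exp(−α²j) · (1 − 2α)/(4α²(j+1)) + c₃ · exp(−2α²j). -/

import Mathlib

open Finset

/-- Probability that exactly `s` of `j` independent Bernoulli trials with
success probabilities `p` succeed. -/
noncomputable def bernCount (j : ℕ) (p : Fin j → ℝ) (s : ℕ) : ℝ :=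
  ∑ B ∈ Finset.powersetCard s (Finset.univ : Finset (Fin j)),
    (∏ l ∈ B, p l) * ∏ l ∈ Bᶜ, (1 - p l)

/-- CDF of the Binomial(n, q) distribution at `s`. -/
noncomputable def binCDF (n : ℕ) (q : ℝ) (s : ℕ) : ℝ :=
  ∑ k ∈ Finset.range (s + 1), (n.choose k : ℝ) * q ^ k * (1 - q) ^ (n - k)

/-- Expectation of `g` of the number of successes among independent Bernoulli trials indexed
by `U`. -/
noncomputable def bernExp {ι : Type*} [DecidableEq ι] (U : Finset ι) (p : ι → ℝ) (g : ℕ → ℝ) : ℝ :=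
  ∑ B ∈ U.powerset, g B.card * ((∏ l ∈ B, p l) * ∏ l ∈ U \ B, (1 - p l))

section bernExp

variable {ι : Type*} [DecidableEq ι]

lemma bernExp_insert {U : Finset ι} {a : ι} (ha : a ∉ U) (p : ι → ℝ) (g : ℕ → ℝ) :
    bernExp (insert a U) p g =
      p a * bernExp U p (fun s => g (s + 1)) + (1 - p a) * bernExp U p g := by
  unfold bernExp
  rw [Finset.sum_powerset_insert ha, add_comm, Finset.mul_sum, Finset.mul_sum]
  congr 1
  · refine Finset.sum_congr rfl fun B hB => ?_
    have haB : a ∉ B := fun h => ha (Finset.mem_powerset.1 hB h)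
    rw [Finset.card_insert_of_notMem haB, Finset.prod_insert haB,
      Finset.insert_sdiff_insert, Finset.sdiff_insert_of_notMem ha]
    ring
  · refine Finset.sum_congr rfl fun B hB => ?_
    have haB : a ∉ B := fun h => ha (Finset.mem_powerset.1 hB h)
    rw [Finset.insert_sdiff_of_notMem _ haB, Finset.prod_insert (by simp [ha])]
    ring

lemma bernExp_mono {U : Finset ι} {p : ι → ℝ} (h0 : ∀ l, 0 ≤ p l) (h1 : ∀ l, p l ≤ 1)
    {g g' : ℕ → ℝ} (hg : ∀ s, g s ≤ g' s) : bernExp U p g ≤ bernExp U p g' :=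
  Finset.sum_le_sum fun _ _ => mul_le_mul_of_nonneg_right (hg _)
    (mul_nonneg (Finset.prod_nonneg fun l _ => h0 l)
      (Finset.prod_nonneg fun l _ => sub_nonneg.2 (h1 l)))

/-- Larger success probabilities decrease the expectation of an antitone function. -/
lemma bernExp_le_of_le {p r : ι → ℝ} (hr0 : ∀ l, 0 ≤ r l) (hrp : ∀ l, r l ≤ p l)
    (hp1 : ∀ l, p l ≤ 1) (U : Finset ι) {g : ℕ → ℝ} (hg : Antitone g) :
    bernExp U p g ≤ bernExp U r g := by
  induction U using Finset.induction_on generalizing g with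
  | empty => simp [bernExp]
  | insert a U ha ih =>
    rw [bernExp_insert ha, bernExp_insert ha]
    have hshift : bernExp U p (fun s => g (s + 1)) ≤ bernExp U p g :=
      bernExp_mono (fun l => (hr0 l).trans (hrp l)) hp1 fun s => hg (Nat.le_succ s)
    have ih₁ : bernExp U p (fun s => g (s + 1)) ≤ bernExp U r (fun s => g (s + 1)) :=
      ih fun s t hst => hg (Nat.succ_le_succ hst)
    have h₁ := mul_le_mul_of_nonneg_left ih₁ (hr0 a)
    have h₂ := mul_le_mul_of_nonneg_left (ih hg) (sub_nonneg.2 ((hrp a).trans (hp1 a)))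
    have h₃ := mul_le_mul_of_nonneg_left hshift (sub_nonneg.2 (hrp a))
    linarith

end bernExp

lemma bernExp_univ_eq_sum_bernCount (j : ℕ) (p : Fin j → ℝ) (g : ℕ → ℝ) :
    bernExp Finset.univ p g = ∑ s ∈ Finset.range (j + 1), bernCount j p s * g s := by
  unfold bernExp bernCount
  rw [Finset.sum_powerset, Finset.card_univ, Fintype.card_fin]
  refine Finset.sum_congr rfl fun s _ => ?_
  rw [Finset.sum_mul]
  refine Finset.sum_congr rfl fun B hB => ?_
  rw [(Finset.mem_powersetCard.1 hB).2, Finset.compl_eq_univ_sdiff, mul_comm]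

lemma bernCount_const (j : ℕ) (r : ℝ) (s : ℕ) :
    bernCount j (fun _ => r) s = (j.choose s : ℝ) * (r ^ s * (1 - r) ^ (j - s)) := by
  unfold bernCount
  rw [Finset.sum_congr rfl (g := fun _ => r ^ s * (1 - r) ^ (j - s))]
  · simp
  · intro B hB
    simp [Finset.card_compl, (Finset.mem_powersetCard.1 hB).2]

/-- Truncated antitone weights: the sum of `bernCount` against them decreases in the success
probabilities. -/
lemma sum_bernCount_mul_le {j m : ℕ} (hm : m ≤ j + 1) {p r : Fin j → ℝ} (hr0 : ∀ l, 0 ≤ r l)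
    (hrp : ∀ l, r l ≤ p l) (hp1 : ∀ l, p l ≤ 1) {g : ℕ → ℝ} (hg : Antitone g)
    (hg0 : ∀ s, 0 ≤ g s) :
    ∑ s ∈ Finset.range m, bernCount j p s * g s ≤
      ∑ s ∈ Finset.range m, bernCount j r s * g s := by
  have key : ∀ q : Fin j → ℝ, ∑ s ∈ Finset.range m, bernCount j q s * g s =
      bernExp Finset.univ q (fun s => if s < m then g s else 0) := by
    intro q
    rw [bernExp_univ_eq_sum_bernCount,
      ← Finset.sum_subset (Finset.range_mono hm) fun s _ hs => by
        rw [if_neg (by simpa using hs), mul_zero]]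
    exact Finset.sum_congr rfl fun s hs => by rw [if_pos (Finset.mem_range.1 hs)]
  rw [key, key]
  refine bernExp_le_of_le hr0 hrp hp1 _ fun s t hst => ?_
  split_ifs with h₁ h₂
  · exact hg hst
  · omega
  · exact hg0 s
  · exact le_rfl

lemma binCDF_pos (n s : ℕ) : 0 < binCDF n (1 / 2) s := by
  unfold binCDF
  rw [Finset.sum_range_succ']
  have : 0 ≤ ∑ k ∈ Finset.range s,
      (n.choose (k + 1) : ℝ) * (1 / 2) ^ (k + 1) * (1 - 1 / 2) ^ (n - (k + 1)) :=
    Finset.sum_nonneg fun k _ => by norm_num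
  have h : (0 : ℝ) < (n.choose 0 : ℝ) * (1 / 2) ^ 0 * (1 - 1 / 2) ^ (n - 0) := by norm_num
  linarith

lemma binCDF_mono (n : ℕ) : Monotone (binCDF n (1 / 2)) := fun s t hst =>
  Finset.sum_le_sum_of_subset_of_nonneg (Finset.range_mono (Nat.succ_le_succ hst))
    fun k _ _ => by norm_num

lemma binCDF_half {n s : ℕ} (hs : s ≤ n) :
    binCDF n (1 / 2) s = (∑ k ∈ Finset.range (s + 1), (n.choose k : ℝ)) / 2 ^ n := by
  unfold binCDF
  rw [Finset.sum_div]
  refine Finset.sum_congr rfl fun k hk => ?_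
  have hkn : k + (n - k) = n := by have := Finset.mem_range.1 hk; omega
  rw [show (1 - 1 / 2 : ℝ) = 1 / 2 by norm_num, mul_assoc, ← pow_add, hkn, one_div, inv_pow,
    div_eq_mul_inv]

/-- Below the middle, a binomial coefficient is a small fraction of the partial row sum. -/
lemma choose_le_mul_sum_choose {n : ℕ} {β : ℝ} (hβ : 0 < β) (hn : 4 ≤ n * β ^ 2) (s : ℕ)
    (hs : 2 * s ≤ n) :
    (n.choose s : ℝ) ≤
      (β + 2 * (n - 2 * s) / n) * ∑ k ∈ Finset.range (s + 1), (n.choose k : ℝ) := by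
  have hn0 : (0 : ℝ) < n := by
    rcases Nat.eq_zero_or_pos n with rfl | h
    · norm_num at hn
    · exact_mod_cast h
  induction s with
  | zero =>
    have : (2 * ((n : ℝ) - 2 * (0 : ℕ)) / n) = 2 := by push_cast; field_simp; ring
    rw [this]
    simp
    linarith
  | succ s ih =>
    have ih := ih (by omega)
    rw [Finset.sum_range_succ]
    set A := ∑ k ∈ Finset.range (s + 1), (n.choose k : ℝ)
    have hsn : 2 * ((s : ℝ) + 1) ≤ n := by exact_mod_cast hs
    have hs0 : (0 : ℝ) ≤ s := s.cast_nonneg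
    have hns : (0 : ℝ) < n - s := by linarith
    have hrec : (n.choose (s + 1) : ℝ) * (s + 1) = n.choose s * (n - s) := by
      have := Nat.choose_succ_right_eq n s
      rw [← Nat.cast_sub (by omega : s ≤ n)]
      exact_mod_cast this
    set c := (n.choose (s + 1) : ℝ)
    have hc0 : 0 ≤ c := Nat.cast_nonneg _
    push_cast
    set d := β + 2 * ((n : ℝ) - 2 * (s + 1)) / n with hd
    have hds : β + 2 * ((n : ℝ) - 2 * s) / n = d + 4 / n := by
      rw [hd]; field_simp; ring
    rw [hds] at ih
    have hquot : 0 ≤ 2 * ((n : ℝ) - 2 * (s + 1)) / n :=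
      div_nonneg (by linarith) hn0.le
    have hβd : β ≤ d := by linarith
    have hd0 : 0 < d := by linarith
    have h4 : 0 < 4 / (n : ℝ) := by positivity
    have hβ2 : 4 / (n : ℝ) ≤ β ^ 2 := by
      rw [div_le_iff₀ hn0]; linarith
    have hq : 1 - (2 * ((n : ℝ) - 2 * (s + 1)) / n + 2 / n) ≤ (s + 1) / (n - s) := by
      rw [le_div_iff₀ hns, ← sub_nonneg]
      have : (s : ℝ) + 1 - (1 - (2 * ((n : ℝ) - 2 * (s + 1)) / n + 2 / n)) * (n - s) =
          (n - 2 * s - 1) * (n - 2 * s) / n := by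
        field_simp; ring
      rw [this]
      exact div_nonneg (mul_nonneg (by linarith) (by linarith)) hn0.le
    have hfac : d + 4 / n ≤ d * ((s + 1) / (n - s)) + d * (d + 4 / n) := by
      have h₁ := mul_le_mul_of_nonneg_left hq hd0.le
      have h₂ : β ^ 2 ≤ d * β := by nlinarith
      have h₃ : d * (d + 4 / n) =
          d * β + d * (2 * ((n : ℝ) - 2 * (s + 1)) / n) + 2 * (d * (2 / n)) := by
        rw [hd]; ring
      have h₄ : 0 ≤ d * (2 / (n : ℝ)) := by positivity
      nlinarith
    have hcs : c * ((s + 1) / (n - s)) ≤ (d + 4 / n) * A := by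
      refine le_trans (le_of_eq ?_) ih
      rw [← mul_div_assoc, hrec, mul_div_assoc, div_self hns.ne', mul_one]
    have hD : 0 < d + 4 / n := by linarith
    refine le_of_mul_le_mul_left ?_ hD
    have h₁ := mul_le_mul_of_nonneg_left hfac hc0
    have h₂ := mul_le_mul_of_nonneg_left hcs hd0.le
    linarith

lemma sum_pow_mul_pow_le {α : ℝ} (h0 : 0 < α) (h1 : α ≤ 1 / 2) {j m : ℕ} (hm : m ≤ j + 1) :
    ∑ s ∈ Finset.range m, (1 + 2 * α) ^ s * (1 - 2 * α) ^ (j - s) ≤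
      1 / (4 * α) * ((1 + 2 * α) ^ m * (1 - 2 * α) ^ (j + 1 - m)) := by
  induction m with
  | zero =>
    have : 0 ≤ 1 - 2 * α := by linarith
    simp only [Finset.range_zero, Finset.sum_empty]
    positivity
  | succ m ih =>
    rw [Finset.sum_range_succ, show j + 1 - (m + 1) = j - m by omega]
    have ih := ih (by omega)
    rw [show j + 1 - m = (j - m) + 1 by omega] at ih
    refine (add_le_add_left ih _).trans (le_of_eq ?_)
    field_simp
    ring

lemma sum_linear_mul_pow_mul_pow_le {α : ℝ} (h0 : 0 < α) (h1 : α ≤ 1 / 2) {j m : ℕ}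
    (hm : m ≤ j + 1) :
    ∑ s ∈ Finset.range m, ((j : ℝ) + 1 - 2 * s) * ((1 + 2 * α) ^ s * (1 - 2 * α) ^ (j - s)) ≤
      (3 / (8 * α ^ 2) + (j - 2 * m) / (4 * α)) *
        ((1 + 2 * α) ^ m * (1 - 2 * α) ^ (j + 1 - m)) := by
  have hx : 0 ≤ 1 - 2 * α := by linarith
  induction m with
  | zero =>
    simp only [Finset.range_zero, Finset.sum_empty, Nat.cast_zero, mul_zero, sub_zero]
    positivity
  | succ m ih =>
    rw [Finset.sum_range_succ, show j + 1 - (m + 1) = j - m by omega]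
    have ih := ih (by omega)
    rw [show j + 1 - m = (j - m) + 1 by omega] at ih
    refine (add_le_add_left ih _).trans ?_
    rw [← sub_nonneg]
    have : (3 / (8 * α ^ 2) + ((j : ℝ) - 2 * (m + 1 : ℕ)) / (4 * α)) *
          ((1 + 2 * α) ^ (m + 1) * (1 - 2 * α) ^ (j - m)) -
        ((3 / (8 * α ^ 2) + ((j : ℝ) - 2 * m) / (4 * α)) *
          ((1 + 2 * α) ^ m * (1 - 2 * α) ^ (j - m + 1)) +
        ((j : ℝ) + 1 - 2 * m) * ((1 + 2 * α) ^ m * (1 - 2 * α) ^ (j - m))) =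
        ((1 - 2 * α) / α) * ((1 + 2 * α) ^ m * (1 - 2 * α) ^ (j - m)) := by
      push_cast
      field_simp
      ring
    rw [this]
    positivity

lemma pow_mul_pow_half_le {α : ℝ} (h0 : 0 < α) (h1 : α ≤ 1 / 2) (j : ℕ) :
    (1 + 2 * α) ^ (j / 2) * (1 - 2 * α) ^ (j + 1 - j / 2) ≤
      Real.exp 1 * Real.exp (-(2 * α ^ 2) * j) * (1 - 2 * α) := by
  have hx : 0 ≤ 1 - 2 * α := by linarith
  obtain ⟨e, he⟩ : ∃ e, j + 1 - j / 2 = j / 2 + (e + 1) := ⟨j - 2 * (j / 2), by omega⟩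
  rw [he, pow_add, ← mul_assoc, ← mul_pow, pow_succ, ← mul_assoc]
  refine mul_le_mul_of_nonneg_right ?_ hx
  have hb : (1 + 2 * α) * (1 - 2 * α) ≤ Real.exp (-(4 * α ^ 2)) := by
    have := Real.add_one_le_exp (-(4 * α ^ 2)); linarith
  have hb0 : 0 ≤ (1 + 2 * α) * (1 - 2 * α) := by positivity
  calc ((1 + 2 * α) * (1 - 2 * α)) ^ (j / 2) * (1 - 2 * α) ^ e
      ≤ Real.exp (-(4 * α ^ 2)) ^ (j / 2) * 1 :=
        mul_le_mul (pow_le_pow_left₀ hb0 hb _) (pow_le_one₀ hx (by linarith))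
          (by positivity) (by positivity)
    _ = Real.exp ((j / 2 : ℕ) * (-(4 * α ^ 2))) := by rw [mul_one, ← Real.exp_nat_mul]
    _ ≤ Real.exp (1 + -(2 * α ^ 2) * j) := by
        refine Real.exp_le_exp.2 ?_
        have hj : (j : ℝ) ≤ 2 * (j / 2 : ℕ) + 1 := by
          exact_mod_cast (by omega : j ≤ 2 * (j / 2) + 1)
        have := mul_le_mul_of_nonneg_left hj (by positivity : 0 ≤ 2 * α ^ 2)
        nlinarith
    _ = Real.exp 1 * Real.exp (-(2 * α ^ 2) * j) := Real.exp_add _ _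

lemma bernCount_const_div_binCDF_le {α : ℝ} (h0 : 0 < α) (h1 : α ≤ 1 / 2) {j s : ℕ}
    (hs : 2 * s ≤ j + 1) (hsj : s ≤ j) :
    bernCount j (fun _ => 1 / 2 + α) s / binCDF (j + 1) (1 / 2) s ≤
      2 * (α + 1 / (α * (j + 1)) + 2 * ((j : ℝ) + 1 - 2 * s) / (j + 1)) *
        ((1 + 2 * α) ^ s * (1 - 2 * α) ^ (j - s)) := by
  have hx : 0 ≤ 1 - 2 * α := by linarith
  rw [div_le_iff₀ (binCDF_pos _ _), bernCount_const, binCDF_half (by omega)]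
  have hβ : 4 ≤ ((j + 1 : ℕ) : ℝ) * (α + 1 / (α * (j + 1))) ^ 2 := by
    have : ((j + 1 : ℕ) : ℝ) * (α + 1 / (α * (j + 1))) ^ 2 - 4 =
        (j + 1) * (α - 1 / (α * (j + 1))) ^ 2 := by
      push_cast; field_simp; ring
    have : 0 ≤ ((j : ℝ) + 1) * (α - 1 / (α * (j + 1))) ^ 2 := by positivity
    linarith
  have hA := choose_le_mul_sum_choose (by positivity) hβ s hs
  have hC : (j.choose s : ℝ) ≤ ((j + 1).choose s : ℝ) := by
    exact_mod_cast Nat.choose_le_choose s (Nat.le_succ j)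
  have hpow : (1 / 2 + α) ^ s * (1 - (1 / 2 + α)) ^ (j - s) =
      (1 + 2 * α) ^ s * (1 - 2 * α) ^ (j - s) / 2 ^ j := by
    rw [show 1 / 2 + α = (1 + 2 * α) / 2 by ring,
      show 1 - (1 + 2 * α) / 2 = (1 - 2 * α) / 2 by ring, div_pow, div_pow, div_mul_div_comm,
      ← pow_add, Nat.add_sub_cancel' hsj]
  push_cast at hA
  rw [hpow]
  have := mul_le_mul_of_nonneg_right (hC.trans hA)
    (by positivity : 0 ≤ (1 + 2 * α) ^ s * (1 - 2 * α) ^ (j - s) / 2 ^ j)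
  refine this.trans (le_of_eq ?_)
  rw [pow_succ]
  field_simp

theorem stmt_4 :
    ∃ c₂ > (0 : ℝ), ∃ c₃ > (0 : ℝ),
      ∀ (α : ℝ), 0 < α → α ≤ 1 / 2 →
      ∀ (j : ℕ), 8 / α < (j : ℝ) →
      ∀ (p : Fin j → ℝ), (∀ l, 0 ≤ p l) → (∀ l, p l ≤ 1) →
        (∀ l, 1 / 2 + α ≤ p l) →
        ∑ s ∈ Finset.range (j / 2), bernCount j p s / binCDF (j + 1) (1 / 2) s
          ≤ c₂ * Real.exp (-(α ^ 2) * j) * (1 - 2 * α) / (4 * α ^ 2 * (j + 1))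
            + c₃ * Real.exp (-(2 * α ^ 2) * j) := by
  refine ⟨10 * Real.exp 1, by positivity, Real.exp 1 / 2, by positivity, ?_⟩
  intro α h0 h1 j _ p _ hp1 hp
  have hx : 0 ≤ 1 - 2 * α := by linarith
  have hm : j / 2 ≤ j + 1 := by omega
  set w : ℕ → ℝ := fun s => (1 + 2 * α) ^ s * (1 - 2 * α) ^ (j - s) with hw
  set P := (1 + 2 * α) ^ (j / 2) * (1 - 2 * α) ^ (j + 1 - j / 2) with hP
  set E := Real.exp (-(2 * α ^ 2) * j) with hE
  have hP0 : 0 ≤ P := by positivity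
  have hconst : ∑ s ∈ Finset.range (j / 2), bernCount j p s / binCDF (j + 1) (1 / 2) s ≤
      ∑ s ∈ Finset.range (j / 2),
        bernCount j (fun _ => 1 / 2 + α) s / binCDF (j + 1) (1 / 2) s := by
    simp only [div_eq_mul_inv _ (binCDF _ _ _)]
    exact sum_bernCount_mul_le hm (fun _ => by positivity) hp hp1
      (fun s t hst => inv_anti₀ (binCDF_pos _ _) (binCDF_mono _ hst))
      fun s => (inv_pos.2 (binCDF_pos _ _)).le
  have hsum : ∑ s ∈ Finset.range (j / 2),
        bernCount j (fun _ => 1 / 2 + α) s / binCDF (j + 1) (1 / 2) s ≤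
      2 * (α + 1 / (α * (j + 1))) * ∑ s ∈ Finset.range (j / 2), w s +
        4 / (j + 1) * ∑ s ∈ Finset.range (j / 2), ((j : ℝ) + 1 - 2 * s) * w s := by
    rw [Finset.mul_sum, Finset.mul_sum, ← Finset.sum_add_distrib]
    refine Finset.sum_le_sum fun s hs => ?_
    have hs := Finset.mem_range.1 hs
    refine (bernCount_const_div_binCDF_le h0 h1 (by omega) (by omega)).trans (le_of_eq ?_)
    simp only [hw]
    ring
  have hlin : (3 / (8 * α ^ 2) + ((j : ℝ) - 2 * (j / 2 : ℕ)) / (4 * α)) * P ≤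
      1 / (2 * α ^ 2) * P := by
    refine mul_le_mul_of_nonneg_right ?_ hP0
    have hj : (j : ℝ) ≤ 2 * (j / 2 : ℕ) + 1 := by
      exact_mod_cast (by omega : j ≤ 2 * (j / 2) + 1)
    have h₁ : ((j : ℝ) - 2 * (j / 2 : ℕ)) / (4 * α) ≤ 1 / (4 * α) := by gcongr; linarith
    have h₂ : 1 / (4 * α) ≤ 1 / (8 * α ^ 2) :=
      one_div_le_one_div_of_le (by positivity) (by nlinarith)
    have h₃ : 3 / (8 * α ^ 2) + 1 / (8 * α ^ 2) = 1 / (2 * α ^ 2) := by field_simp; norm_num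
    linarith
  have h₁ := mul_le_mul_of_nonneg_left (sum_pow_mul_pow_le h0 h1 hm)
    (by positivity : 0 ≤ 2 * (α + 1 / (α * (j + 1))))
  have h₂ := mul_le_mul_of_nonneg_left ((sum_linear_mul_pow_mul_pow_le h0 h1 hm).trans hlin)
    (by positivity : (0 : ℝ) ≤ 4 / (j + 1))
  have htotal : 2 * (α + 1 / (α * (j + 1))) * (1 / (4 * α) * P) +
      4 / (j + 1) * (1 / (2 * α ^ 2) * P) = (1 / 2 + 5 / (2 * α ^ 2 * (j + 1))) * P := by
    field_simp; ring
  have h₃ := mul_le_mul_of_nonneg_left (pow_mul_pow_half_le h0 h1 j)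
    (by positivity : (0 : ℝ) ≤ 1 / 2 + 5 / (2 * α ^ 2 * (j + 1)))
  have hEE : E ≤ Real.exp (-(α ^ 2) * j) := by
    refine Real.exp_le_exp.2 ?_
    have : 0 ≤ α ^ 2 * j := by positivity
    linarith
  calc _ ≤ (1 / 2 + 5 / (2 * α ^ 2 * (j + 1))) * (Real.exp 1 * E * (1 - 2 * α)) := by linarith
    _ = 10 * Real.exp 1 * E * (1 - 2 * α) / (4 * α ^ 2 * (j + 1)) +
        Real.exp 1 / 2 * E * (1 - 2 * α) := by field_simp; ring
    _ ≤ _ := by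
      refine add_le_add ?_ (mul_le_of_le_one_right (by positivity) (by linarith))
      gcongr
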